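/- Fix a prime p and a finite extension K of ℚ_p with algebraic closure K̄, and let v_p be the valuation on K̄ normalized by v_p(p) = 1. Fix a compatible system of primitive p^n-th roots of unity ε^{(n)} ∈ K̄ (ε^{(0)} = 1, ε^{(1)} ≠ 1, (ε^{(n+1)})^p = ε^{(n)}) and let K_n = K(ε^{(n)}). Then for each n ≥ 0 there exists a constant c ∈ ℝ (depending only on K and n) such that for all m ≥ n and all x ∈ K_m, v_p( [K_m : K_n]^{-1} · Tr_{K_m/K_n}(x) ) ≥ v_p(x) − c. In other words, the normalized trace maps [K_m:K_n]^{-1}·Tr_{K_m/K_n} : K_m → K_n are uniformly bounded in m. -/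

import Mathlib

open Polynomial in
theorem exists_aeval_eq_of_mem_adjoin_simple {F L : Type*} [Field F] [Field L] [Algebra F L]
    {x y : L} (hx : IsIntegral F x) (hy : y ∈ IntermediateField.adjoin F {x}) :
    ∃ g : F[X], g.natDegree < (minpoly F x).natDegree ∧ aeval x g = y := by
  obtain ⟨g, hg, h⟩ := (IntermediateField.adjoin.powerBasis hx).exists_eq_aeval ⟨y, hy⟩
  refine ⟨g, hg, ?_⟩
  have := congrArg (algebraMap (IntermediateField.adjoin F {x}) L) h
  rw [← aeval_algebraMap_apply, IntermediateField.adjoin.powerBasis_gen,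
    IntermediateField.AdjoinSimple.algebraMap_gen] at this
  exact this.symm

section Cyclotomic

open Polynomial

theorem monic_cyclotomic_prime_pow_comp_X_add_one (p : ℕ) (R : Type*) [CommRing R]
    (k : ℕ) :
    ((cyclotomic (p ^ (k + 1)) R).comp (X + 1)).Monic := by
  rw [← C_1]
  exact (cyclotomic.monic _ R).comp_X_add_C 1

variable (p : ℕ) [Fact p.Prime]

theorem padicInt_irreducible_cyclotomic_comp (k : ℕ) :
    Irreducible ((cyclotomic (p ^ (k + 1)) ℤ_[p]).comp (X + 1)) := by
  have hmonic := monic_cyclotomic_prime_pow_comp_X_add_one p ℤ_[p] k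
  have hmap : (cyclotomic (p ^ (k + 1)) ℤ_[p]).comp (X + 1) =
      ((cyclotomic (p ^ (k + 1)) ℤ).comp (X + 1)).map (algebraMap ℤ ℤ_[p]) := by
    simp [Polynomial.map_comp]
  have hprime : (Ideal.span {(p : ℤ_[p])}).IsPrime :=
    (Ideal.span_singleton_prime PadicInt.prime_p.ne_zero).2 PadicInt.prime_p
  have hdeg : ((cyclotomic (p ^ (k + 1)) ℤ_[p]).comp (X + 1)).natDegree =
      Nat.totient (p ^ (k + 1)) := by
    rw [← C_1, natDegree_comp, natDegree_X_add_C, natDegree_cyclotomic, mul_one]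
  refine (hmonic.isEisensteinAt_of_mem_of_notMem hprime.ne_top ?_ ?_).irreducible hprime
    hmonic.isPrimitive ?_
  · have h := (cyclotomic_prime_pow_comp_X_add_one_isEisensteinAt p k).isWeaklyEisensteinAt.map
      (algebraMap ℤ ℤ_[p])
    rw [← hmap] at h
    intro n hn
    simpa [Ideal.submodule_span_eq, Ideal.map_span] using h.mem hn
  · have h0 : ((cyclotomic (p ^ (k + 1)) ℤ_[p]).comp (X + 1)).coeff 0 = p := by
      rw [coeff_zero_eq_eval_zero, eval_comp]
      simp [eval_one_cyclotomic_prime_pow]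
    rw [h0, Ideal.span_singleton_pow, Ideal.mem_span_singleton]
    intro hd
    have := (pow_dvd_pow_iff (n := 2) (m := 1) PadicInt.prime_p.ne_zero
      (PadicInt.prime_p (p := p)).not_isUnit).1 (by simpa using hd)
    omega
  · rw [hdeg]
    exact Nat.totient_pos.2 (pow_pos (Fact.out : p.Prime).pos _)

variable {L : Type*} [Field L] [Algebra ℚ_[p] L]

theorem minpoly_padic_sub_one {ζ : L} {k : ℕ} (hζ : IsPrimitiveRoot ζ (p ^ (k + 1))) :
    minpoly ℚ_[p] (ζ - 1) = (cyclotomic (p ^ (k + 1)) ℚ_[p]).comp (X + 1) := by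
  have hirr : Irreducible ((cyclotomic (p ^ (k + 1)) ℚ_[p]).comp (X + 1)) := by
    have := ((monic_cyclotomic_prime_pow_comp_X_add_one p ℤ_[p]
      k).irreducible_iff_irreducible_map_fraction_map (K := ℚ_[p])).1
      (padicInt_irreducible_cyclotomic_comp p k)
    simpa [Polynomial.map_comp] using this
  refine (minpoly.eq_of_irreducible_of_monic hirr ?_
    (monic_cyclotomic_prime_pow_comp_X_add_one p ℚ_[p] k)).symm
  rw [aeval_comp]
  have := hζ.isRoot_cyclotomic (pow_pos (Fact.out : p.Prime).pos _)
  rw [IsRoot.def, ← map_cyclotomic _ (algebraMap ℚ_[p] L), eval_map_algebraMap] at this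
  simpa using this

theorem natDegree_minpoly_padic_sub_one {ζ : L} {k : ℕ} (hζ : IsPrimitiveRoot ζ (p ^ (k + 1))) :
    (minpoly ℚ_[p] (ζ - 1)).natDegree = Nat.totient (p ^ (k + 1)) := by
  rw [minpoly_padic_sub_one p hζ, ← C_1, natDegree_comp, natDegree_X_add_C, natDegree_cyclotomic,
    mul_one]

end Cyclotomic

section Norm

open Polynomial

variable (p : ℕ) [Fact p.Prime] {L : Type*} [NormedField L] [NormedAlgebra ℚ_[p] L]
  [Algebra.IsAlgebraic ℚ_[p] L]

theorem norm_sub_one_pow_totient {ζ : L} {k : ℕ} (hζ : IsPrimitiveRoot ζ (p ^ (k + 1))) :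
    ‖ζ - 1‖ ^ Nat.totient (p ^ (k + 1)) = (p : ℝ)⁻¹ := by
  have hpos : 0 < Nat.totient (p ^ (k + 1)) :=
    Nat.totient_pos.2 (pow_pos (Fact.out : p.Prime).pos _)
  rw [NormedAlgebra.norm_eq_spectralNorm ℚ_[p],
    spectralNorm.spectralNorm_eq_norm_coeff_zero_rpow, natDegree_minpoly_padic_sub_one p hζ,
    minpoly_padic_sub_one p hζ, one_div, Real.rpow_inv_natCast_pow (norm_nonneg _) hpos.ne',
    coeff_zero_eq_eval_zero, eval_comp]
  simp [eval_one_cyclotomic_prime_pow]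

/-- Galois conjugate elements have the same norm. -/
theorem norm_eq_of_minpoly_eq {x y : L} (h : minpoly ℚ_[p] x = minpoly ℚ_[p] y) : ‖x‖ = ‖y‖ := by
  rw [NormedAlgebra.norm_eq_spectralNorm ℚ_[p], NormedAlgebra.norm_eq_spectralNorm ℚ_[p],
    spectralNorm, spectralNorm, h]

variable [IsUltrametricDist L]

theorem norm_coeff_le_of_natDegree_lt_totient {ζ : L} {k : ℕ}
    (hζ : IsPrimitiveRoot ζ (p ^ (k + 1))) {g : ℚ_[p][X]}
    (hg : g.natDegree < Nat.totient (p ^ (k + 1))) (j : ℕ) :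
    ‖g.coeff j‖ ≤ p * ‖aeval (ζ - 1) g‖ := by
  have hp1 : (1 : ℝ) < p := by exact_mod_cast (Fact.out : p.Prime).one_lt
  have hp0 : (0 : ℝ) < p := by linarith
  set φ := Nat.totient (p ^ (k + 1)) with hφ
  set π : L := ζ - 1 with hπ
  have hnorm : ‖π‖ ^ φ = (p : ℝ)⁻¹ := norm_sub_one_pow_totient p hζ
  have hφ0 : φ ≠ 0 := by omega
  have hπ0 : 0 < ‖π‖ := by
    refine (norm_nonneg _).lt_of_ne fun h => ?_
    rw [← h, zero_pow hφ0] at hnorm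
    exact (inv_pos.2 hp0).ne hnorm
  have hπ1 : ‖π‖ ≤ 1 := by
    by_contra! h
    have := one_lt_pow₀ h hφ0
    rw [hnorm] at this
    exact absurd this (not_lt.2 (inv_le_one_of_one_le₀ hp1.le))
  by_cases hg0 : g = 0
  · simp [hg0]
  obtain ⟨i, hi, hmax⟩ := g.support.exists_max_image (fun j => ‖g.coeff j‖ * ‖π‖ ^ j)
    (nonempty_support_iff.2 hg0)
  have key : ∀ a ∈ g.support, (‖g.coeff a‖ * ‖π‖ ^ a) ^ φ =
      (p : ℝ) ^ (-((g.coeff a).valuation * φ + a)) := by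
    intro a ha
    rw [mul_pow, ← pow_mul, mul_comm a φ, pow_mul, hnorm,
      Padic.norm_eq_zpow_neg_valuation (mem_support_iff.1 ha), neg_add, zpow_add₀ hp0.ne',
      ← neg_mul, zpow_mul, zpow_neg _ (a : ℤ), inv_pow, zpow_natCast, zpow_natCast]
  have hstrict : ∀ a ∈ g.support, a ≠ i → ‖g.coeff a‖ * ‖π‖ ^ a < ‖g.coeff i‖ * ‖π‖ ^ i := by
    intro a ha hai
    refine (hmax a ha).lt_of_ne fun h => hai ?_
    have h2 := congrArg (· ^ φ) h
    simp only [key a ha, key i hi] at h2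
    have h3 := zpow_right_injective₀ hp0 hp1.ne' h2
    have ha' : a < φ := (le_natDegree_of_mem_supp a ha).trans_lt hg
    have hi' : i < φ := (le_natDegree_of_mem_supp i hi).trans_lt hg
    have h4 : (g.coeff a).valuation * φ + a = (g.coeff i).valuation * φ + i := by
      simpa only [neg_inj] using h3
    have h5 := congrArg (· % (φ : ℤ)) h4
    simp only [Int.add_comm _ (a : ℤ), Int.add_comm _ (i : ℤ), Int.add_mul_emod_self_right] at h5
    rw [Int.emod_eq_of_lt (by positivity) (by exact_mod_cast ha'),
      Int.emod_eq_of_lt (by positivity) (by exact_mod_cast hi')] at h5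
    exact_mod_cast h5
  have hsum : ‖aeval π g‖ = ‖g.coeff i‖ * ‖π‖ ^ i := by
    rw [aeval_eq_sum_range, ← Finset.sum_subset (s₁ := g.support)
      (fun a ha => Finset.mem_range_succ_iff.2 (le_natDegree_of_mem_supp a ha))
      (fun a _ ha => by rw [notMem_support_iff.1 ha, zero_smul])]
    have := IsUltrametricDist.isNonarchimedean_norm.apply_sum_eq_of_lt (R := ℝ) (α := L)
      (f := fun x => ‖x‖) (fun a => (norm_neg a).symm) (s := g.support)
      (l := fun a => g.coeff a • π ^ a) (k := i) hi
      (fun a ha hai => by simpa [norm_smul] using hstrict a ha hai)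
    simpa [norm_smul] using this
  by_cases hj : j ∈ g.support
  · rw [hsum]
    have h1 : (p : ℝ)⁻¹ ≤ ‖π‖ ^ j := by
      rw [← hnorm]
      exact pow_le_pow_of_le_one hπ0.le hπ1 ((le_natDegree_of_mem_supp j hj).trans hg.le)
    calc ‖g.coeff j‖ = p * (‖g.coeff j‖ * (p : ℝ)⁻¹) := by field_simp
      _ ≤ p * (‖g.coeff j‖ * ‖π‖ ^ j) := by gcongr
      _ ≤ _ := by exact mul_le_mul_of_nonneg_left (hmax j hj) hp0.le
  · rw [notMem_support_iff.1 hj, norm_zero]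
    positivity

end Norm

section NormalizedTrace

/-- The normalized trace of `L` over `E`, viewed as an `E`-linear endomorphism of `L`. -/
noncomputable def normalizedTraceEnd (E L : Type*) [Field E] [Field L] [Algebra E L] [CharZero E]
    [Algebra.IsIntegral E L] : L →ₗ[E] L :=
  Algebra.linearMap E L ∘ₗ Algebra.normalizedTrace E L

theorem normalizedTraceEnd_apply {E L : Type*} [Field E] [Field L] [Algebra E L] [CharZero E]
    [Algebra.IsIntegral E L] (x : L) :
    normalizedTraceEnd E L x = algebraMap E L (Algebra.normalizedTrace E L x) :=
  rfl

theorem normalizedTraceEnd_algebraMap {E L : Type*} [Field E] [Field L] [Algebra E L] [CharZero E]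
    [Algebra.IsIntegral E L] (x : E) :
    normalizedTraceEnd E L (algebraMap E L x) = algebraMap E L x := by
  rw [normalizedTraceEnd_apply, Algebra.normalizedTrace_algebraMap_apply E E L,
    Algebra.normalizedTrace_self_apply]

theorem normalizedTraceEnd_normalizedTraceEnd {K L : Type*} [Field K] [Field L] [Algebra K L]
    [CharZero K] [Algebra.IsIntegral K L] {E₁ E₂ : IntermediateField K L} (h : E₁ ≤ E₂) (x : L) :
    normalizedTraceEnd E₁ L (normalizedTraceEnd E₂ L x) = normalizedTraceEnd E₁ L x := by
  let : Algebra E₁ E₂ := (IntermediateField.inclusion h).toAlgebra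
  have : IsScalarTower E₁ E₂ L := .of_algebraMap_eq' rfl
  have : Algebra.IsIntegral E₁ E₂ :=
    Algebra.IsIntegral.of_injective (IsScalarTower.toAlgHom E₁ E₂ L) (algebraMap E₂ L).injective
  rw [normalizedTraceEnd_apply (E := E₁), normalizedTraceEnd_apply (E := E₁),
    normalizedTraceEnd_apply (E := E₂), Algebra.normalizedTrace_algebraMap_apply E₁ E₂ L,
    Algebra.normalizedTrace_trans_apply]

theorem normalizedTraceEnd_eq_of_mem {E L : Type*} [Field E] [Field L] [Algebra E L] [CharZero E]
    [Algebra.IsIntegral E L] (M : IntermediateField E L) [FiniteDimensional E M] {x : L}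
    (hx : x ∈ M) : normalizedTraceEnd E L x =
      (Module.finrank E M : L)⁻¹ * algebraMap E L (Algebra.trace E M ⟨x, hx⟩) := by
  have := Algebra.normalizedTrace_intermediateField E L (E := M) ⟨x, hx⟩
  rw [normalizedTraceEnd_apply, this, Algebra.normalizedTrace_eq_of_finiteDimensional_apply]
  simp

open Polynomial in
theorem normalizedTraceEnd_eq_zero_of_minpoly {E L : Type*} [Field E] [Field L] [Algebra E L]
    [CharZero E] [Algebra.IsIntegral E L] {x : L} {c : E} {n : ℕ} (hn : 2 ≤ n)
    (h : minpoly E x = X ^ n - C c) : normalizedTraceEnd E L x = 0 := by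
  have hn0 : n ≠ 0 := by omega
  rw [normalizedTraceEnd_apply, Algebra.normalizedTrace_minpoly, h,
    nextCoeff_of_natDegree_pos (by rw [natDegree_X_pow_sub_C]; omega), natDegree_X_pow_sub_C,
    coeff_sub, coeff_X_pow, coeff_C, if_neg (by omega), if_neg (by omega)]
  simp

variable (p : ℕ) [Fact p.Prime] {L : Type*} [NormedField L] [NormedAlgebra ℚ_[p] L]
  [IsUltrametricDist L] [Algebra.IsAlgebraic ℚ_[p] L] [IsAlgClosed L]

theorem norm_normalizedTraceEnd_le_of_mem {E : Type*} [Field E] [CharZero E] [Algebra ℚ_[p] E]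
    [Algebra E L] [Algebra.IsIntegral E L] [IsScalarTower ℚ_[p] E L] (M : IntermediateField E L)
    [FiniteDimensional E M] {x : L} (hx : x ∈ M) :
    ‖normalizedTraceEnd E L x‖ ≤ ‖(Module.finrank E M : L)‖⁻¹ * ‖x‖ := by
  rw [normalizedTraceEnd_eq_of_mem M hx, norm_mul, norm_inv, trace_eq_sum_embeddings L]
  gcongr
  refine IsUltrametricDist.norm_sum_le_of_forall_le_of_nonneg (norm_nonneg _) fun σ _ => ?_
  refine (norm_eq_of_minpoly_eq p ?_).le
  rw [show σ ⟨x, hx⟩ = σ.restrictScalars ℚ_[p] ⟨x, hx⟩ from rfl,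
    minpoly.algHom_eq _ (σ.restrictScalars ℚ_[p]).injective,
    ← minpoly.algHom_eq (M.val.restrictScalars ℚ_[p]) (M.val.restrictScalars ℚ_[p]).injective]
  rfl

open Polynomial in
theorem exists_bound_coeff_of_mem_adjoin_simple (α : L) :
    ∃ (C : ℝ) (D : ℕ), 0 ≤ C ∧ ∀ F : IntermediateField ℚ_[p] L,
      ∀ x ∈ IntermediateField.adjoin F {α}, ∃ g : F[X], aeval α g = x ∧ g.natDegree ≤ D ∧
        ∀ j, ‖(g.coeff j : L)‖ ≤ C * ‖x‖ := by
  classical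
  set S₀ : Finset L := ((minpoly ℚ_[p] α).aroots L).toFinset with hS₀
  let B : Finset L → L → ℝ := fun S s =>
    ∑ j ∈ (Lagrange.basis S id s).support, ‖(Lagrange.basis S id s).coeff j‖
  have hB : ∀ S s, 0 ≤ B S s := fun S s => Finset.sum_nonneg fun _ _ => norm_nonneg _
  have hBj : ∀ S s j, ‖(Lagrange.basis S id s).coeff j‖ ≤ B S s := by
    intro S s j
    by_cases hj : j ∈ (Lagrange.basis S id s).support
    · exact Finset.single_le_sum (f := fun j => ‖(Lagrange.basis S id s).coeff j‖)
        (fun _ _ => norm_nonneg _) hj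
    · rw [notMem_support_iff.1 hj, norm_zero]
      exact hB S s
  let C : ℝ := ∑ S ∈ S₀.powerset, ∑ s ∈ S₀, B S s
  have hC : 0 ≤ C := Finset.sum_nonneg fun S _ => Finset.sum_nonneg fun s _ => hB S s
  have hBC : ∀ S ⊆ S₀, ∀ s ∈ S, B S s ≤ C := by
    intro S hS s hs
    refine (Finset.single_le_sum (f := fun s => B S s) (fun s _ => hB S s) (hS hs)).trans ?_
    exact Finset.single_le_sum (f := fun S => ∑ s ∈ S₀, B S s)
      (fun S _ => Finset.sum_nonneg fun s _ => hB S s) (Finset.mem_powerset.2 hS)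
  refine ⟨C, S₀.card, hC, fun F x hx => ?_⟩
  have hint : ∀ y : L, IsIntegral F y := fun y => (Algebra.IsIntegral.isIntegral
    (R := ℚ_[p]) y).tower_top
  obtain ⟨g, hg, rfl⟩ := exists_aeval_eq_of_mem_adjoin_simple (hint α) hx
  set S : Finset L := ((minpoly F α).aroots L).toFinset with hS
  have hne := minpoly.ne_zero (hint α)
  have hsub : S ⊆ S₀ := by
    intro s hs
    rw [hS, Multiset.mem_toFinset, mem_aroots] at hs
    rw [hS₀, Multiset.mem_toFinset, mem_aroots]
    refine ⟨minpoly.ne_zero (Algebra.IsIntegral.isIntegral α), ?_⟩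
    have := aeval_eq_zero_of_dvd_aeval_eq_zero (minpoly.dvd_map_of_isScalarTower ℚ_[p] F α) hs.2
    rwa [aeval_map_algebraMap] at this
  have hcard : S.card = (minpoly F α).natDegree := by
    rw [hS, Multiset.toFinset_card_of_nodup, ← natDegree_map (algebraMap F L), aroots,
      (IsAlgClosed.splits _).natDegree_eq_card_roots]
    have hsep : (minpoly F α).Separable := (minpoly.irreducible (hint α)).separable
    exact nodup_roots hsep.map
  refine ⟨g, rfl, (hcard ▸ hg.le).trans (Finset.card_le_card hsub), fun j => ?_⟩
  have hval : ∀ s ∈ S, ‖aeval s g‖ = ‖aeval α g‖ := by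
    intro s hs
    rw [hS, Multiset.mem_toFinset, mem_aroots] at hs
    obtain ⟨φ, rfl⟩ := IntermediateField.exists_algHom_of_splits_of_aeval (F := F) (E := L)
      (K := L) (fun y => ⟨hint y, IsAlgClosed.splits _⟩) hs.2
    refine norm_eq_of_minpoly_eq p ?_
    rw [aeval_algHom_apply]
    exact minpoly.algHom_eq (φ.restrictScalars ℚ_[p]) (φ.restrictScalars ℚ_[p]).injective _
  have hdeg : (g.map (algebraMap F L)).degree < S.card := by
    rw [degree_map, hcard]
    exact degree_le_natDegree.trans_lt (by exact_mod_cast hg)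
  have hL := Lagrange.eq_interpolate (s := S) (v := id) Function.injective_id.injOn hdeg
  have hcoeff : (g.coeff j : L) = (g.map (algebraMap F L)).coeff j := by
    rw [coeff_map]; rfl
  rw [hcoeff, hL, Lagrange.interpolate_apply, finsetSum_coeff]
  refine IsUltrametricDist.norm_sum_le_of_forall_le_of_nonneg (by positivity) fun s hs => ?_
  rw [coeff_C_mul, norm_mul, mul_comm, id, eval_map_algebraMap, hval s hs]
  gcongr
  exact (hBj S s j).trans (hBC S hsub s hs)

end NormalizedTrace

section Tower

open Polynomial

theorem natDegree_minpoly_le_of_le {k L : Type*} [Field k] [Field L] [Algebra k L]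
    [Algebra.IsIntegral k L] {F₁ F₂ : IntermediateField k L} (h : F₁ ≤ F₂) (α : L) :
    (minpoly F₂ α).natDegree ≤ (minpoly F₁ α).natDegree := by
  have hint : IsIntegral F₁ α := (Algebra.IsIntegral.isIntegral (R := k) α).tower_top
  have hm := minpoly.monic hint
  rw [← hm.natDegree_map (IntermediateField.inclusion h).toRingHom]
  refine natDegree_le_natDegree (minpoly.min _ _ (hm.map _) ?_)
  rw [aeval_def, eval₂_map]
  exact minpoly.aeval F₁ α

theorem exists_natDegree_minpoly_eq {k L : Type*} [Field k] [Field L] [Algebra k L]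
    [Algebra.IsIntegral k L] {F : ℕ → IntermediateField k L} (hF : Monotone F) (α : L) :
    ∃ N, ∀ m, N ≤ m → (minpoly (F m) α).natDegree = (minpoly (F N) α).natDegree := by
  let a : ℕ → ℕ := fun m => (minpoly (F m) α).natDegree
  obtain ⟨N, hN⟩ : ∃ N, a N = sInf (Set.range a) := Nat.sInf_mem (Set.range_nonempty a)
  exact ⟨N, fun m hm => le_antisymm (natDegree_minpoly_le_of_le (hF hm) α)
    (hN.trans_le (Nat.sInf_le ⟨m, rfl⟩))⟩

theorem restrictScalars_adjoin_simple_comm {k K L : Type*} [Field k] [Field K] [Field L]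
    [Algebra k K] [Algebra k L] [Algebra K L] [IsScalarTower k K L] {α : K}
    (hα : IntermediateField.adjoin k {α} = ⊤) (e : L) :
    (IntermediateField.adjoin (IntermediateField.adjoin k {e})
      {algebraMap K L α}).restrictScalars k =
      (IntermediateField.adjoin K {e}).restrictScalars k := by
  rw [IntermediateField.adjoin_adjoin_left]
  set M := IntermediateField.adjoin k ({e} ∪ {algebraMap K L α}) with hM
  apply le_antisymm
  · rw [hM, IntermediateField.adjoin_le_iff]
    rintro x (rfl | rfl)
    · exact IntermediateField.mem_adjoin_simple_self K x
    · exact (IntermediateField.adjoin K {e}).algebraMap_mem α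
  · have hK : ∀ y : K, algebraMap K L y ∈ M := by
      intro y
      have hle : IntermediateField.adjoin k {α} ≤
          M.comap (IsScalarTower.toAlgHom k K L) := by
        rw [IntermediateField.adjoin_simple_le_iff]
        exact IntermediateField.subset_adjoin _ _ (Or.inr rfl)
      exact hle (hα ▸ IntermediateField.mem_top)
    intro x hx
    refine IntermediateField.adjoin_induction K (p := fun x _ => x ∈ M) ?_ hK
      (fun _ _ _ _ => add_mem) (fun _ _ => inv_mem) (fun _ _ _ _ => mul_mem) hx
    rintro _ rfl
    exact IntermediateField.subset_adjoin _ _ (Or.inl rfl)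

theorem finrank_adjoin_simple_eq_mul {k K L : Type*} [Field k] [Field K] [Field L]
    [Algebra k K] [Algebra k L] [Algebra K L] [IsScalarTower k K L] [Algebra.IsIntegral k L]
    {α : K} (hα : IntermediateField.adjoin k {α} = ⊤) (e : L) :
    Module.finrank k (IntermediateField.adjoin K {e}) =
      Module.finrank k (IntermediateField.adjoin k {e}) *
        (minpoly (IntermediateField.adjoin k {e}) (algebraMap K L α)).natDegree := by
  have hint : IsIntegral (IntermediateField.adjoin k {e}) (algebraMap K L α) :=
    (Algebra.IsIntegral.isIntegral (R := k) _).tower_top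
  rw [← IntermediateField.adjoin.finrank hint, Module.finrank_mul_finrank]
  exact congrArg (fun M : IntermediateField k L => Module.finrank k M)
    (restrictScalars_adjoin_simple_comm hα e).symm

theorem isScalarTower_intermediateField {k K L : Type*} [Field k] [Field K] [Field L]
    [Algebra k K] [Algebra k L] [Algebra K L] [IsScalarTower k K L] (E : IntermediateField K L) :
    IsScalarTower k E L :=
  .of_algebraMap_eq fun x => by
    rw [IsScalarTower.algebraMap_apply k K L, IsScalarTower.algebraMap_apply k K E,
      ← IsScalarTower.algebraMap_apply K E L]

theorem minpoly_eq_X_pow_sub_C {k K L : Type*} [Field k] [Field K] [Field L]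
    [Algebra k K] [Algebra k L] [Algebra K L] [IsScalarTower k K L] [FiniteDimensional k K]
    [Algebra.IsIntegral K L] (E : IntermediateField K L) [FiniteDimensional K E] {e y : L} {n : ℕ}
    (hn : n ≠ 0) (hrank : Module.finrank k (IntermediateField.adjoin K {e}) =
      n * Module.finrank k E)
    (c : E) (hy : y ^ n = c) (he : e ∈ IntermediateField.adjoin E {y}) :
    minpoly E y = X ^ n - C c := by
  have hint : IsIntegral E y := (Algebra.IsIntegral.isIntegral (R := K) y).tower_top
  have : IsScalarTower k E L := isScalarTower_intermediateField E
  have : FiniteDimensional k E := Module.Finite.trans K E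
  have : FiniteDimensional E (IntermediateField.adjoin E {y}) :=
    IntermediateField.adjoin.finiteDimensional hint
  have : FiniteDimensional k (IntermediateField.adjoin E {y}) := Module.Finite.trans E _
  have hroot : aeval y (X ^ n - C c) = 0 := by
    simp [hy]
  have hmonic : (X ^ n - C c).Monic := monic_X_pow_sub_C c hn
  have hle : IntermediateField.adjoin K {e} ≤
      (IntermediateField.adjoin E {y}).restrictScalars K := by
    rw [IntermediateField.adjoin_simple_le_iff]
    exact he
  have hfin : Module.finrank k (IntermediateField.adjoin K {e}) ≤
      Module.finrank k (IntermediateField.adjoin E {y}) :=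
    LinearMap.finrank_le_finrank_of_injective (R := k)
      (M' := IntermediateField.adjoin E {y})
      (f := ((IntermediateField.inclusion hle).restrictScalars k).toLinearMap)
      (IntermediateField.inclusion hle).injective
  rw [hrank, ← Module.finrank_mul_finrank k E (IntermediateField.adjoin E {y}),
     IntermediateField.adjoin.finrank hint,
    mul_comm] at hfin
  have hdeg := Nat.le_of_mul_le_mul_left hfin Module.finrank_pos
  refine (eq_of_monic_of_dvd_of_natDegree_le (minpoly.monic hint) hmonic
    (minpoly.dvd E y hroot) ?_).symm
  rwa [natDegree_X_pow_sub_C]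

end Tower

section CyclotomicTower

open Polynomial

theorem isPrimitiveRoot_of_compatible (p : ℕ) [Fact p.Prime] {L : Type*} [Field L]
    {ε : ℕ → L} (hε0 : ε 0 = 1) (hε1 : ε 1 ≠ 1) (hεp : ∀ n, ε (n + 1) ^ p = ε n) (k : ℕ) :
    IsPrimitiveRoot (ε (k + 1)) (p ^ (k + 1)) := by
  have hpow : ∀ j m, ε (m + j) ^ p ^ j = ε m := by
    intro j
    induction j with
    | zero => simp
    | succ j ih => intro m; rw [pow_succ', pow_mul, ← add_assoc, hεp, ih]
  rw [IsPrimitiveRoot.iff_orderOf]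
  refine orderOf_eq_prime_pow ?_ ?_
  · rwa [add_comm, hpow k 1]
  · simpa [hε0] using hpow (k + 1) 0

theorem adjoin_simple_mono_of_compatible (p : ℕ) {K L : Type*} [Field K] [Field L]
    [Algebra K L] {ε : ℕ → L} (hεp : ∀ n, ε (n + 1) ^ p = ε n) :
    Monotone fun m => IntermediateField.adjoin K {ε m} := by
  refine monotone_nat_of_le_succ fun m => ?_
  rw [IntermediateField.adjoin_simple_le_iff, ← hεp m]
  exact pow_mem (IntermediateField.mem_adjoin_simple_self K _) p

theorem adjoin_simple_sub_one {K L : Type*} [Field K] [Field L] [Algebra K L] (x : L) :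
    IntermediateField.adjoin K {x - 1} = IntermediateField.adjoin K {x} := by
  apply le_antisymm <;> rw [IntermediateField.adjoin_simple_le_iff]
  · exact sub_mem (IntermediateField.mem_adjoin_simple_self K x) (one_mem _)
  · simpa using add_mem (IntermediateField.mem_adjoin_simple_self K (x - 1)) (one_mem _)

variable (p : ℕ) [hp : Fact p.Prime]

theorem finrank_adjoin_simple_primitiveRoot {L : Type*} [Field L] [Algebra ℚ_[p] L]
    [Algebra.IsIntegral ℚ_[p] L] {ζ : L} {k : ℕ} (hζ : IsPrimitiveRoot ζ (p ^ (k + 1))) :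
    Module.finrank ℚ_[p] (IntermediateField.adjoin ℚ_[p] {ζ}) = Nat.totient (p ^ (k + 1)) := by
  rw [← natDegree_minpoly_padic_sub_one p hζ,
    ← IntermediateField.adjoin.finrank (Algebra.IsIntegral.isIntegral _),
    adjoin_simple_sub_one]

variable {K L : Type*} [Field K] [Algebra ℚ_[p] K] [FiniteDimensional ℚ_[p] K]

theorem exists_finrank_succ_eq_mul [Field L] [Algebra ℚ_[p] L] [Algebra.IsIntegral ℚ_[p] L]
    [Algebra K L] [IsScalarTower ℚ_[p] K L] {ε : ℕ → L} (hε0 : ε 0 = 1)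
    (hε1 : ε 1 ≠ 1) (hεp : ∀ n, ε (n + 1) ^ p = ε n) :
    ∃ N, ∀ m, N ≤ m → Module.finrank ℚ_[p] (IntermediateField.adjoin K {ε (m + 1)}) =
      p * Module.finrank ℚ_[p] (IntermediateField.adjoin K {ε m}) := by
  obtain ⟨α, hα⟩ := Field.exists_primitive_element ℚ_[p] K
  obtain ⟨N, hN⟩ := exists_natDegree_minpoly_eq
    (adjoin_simple_mono_of_compatible (K := ℚ_[p]) p hεp) (algebraMap K L α)
  refine ⟨N + 1, fun m hm => ?_⟩
  obtain ⟨k, rfl⟩ : ∃ k, m = k + 1 := ⟨m - 1, by omega⟩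
  have hprim := isPrimitiveRoot_of_compatible p hε0 hε1 hεp
  rw [finrank_adjoin_simple_eq_mul hα, finrank_adjoin_simple_eq_mul hα,
    finrank_adjoin_simple_primitiveRoot p (hprim _),
    finrank_adjoin_simple_primitiveRoot p (hprim _), hN (k + 1 + 1) (by omega),
    hN (k + 1) (by omega), Nat.totient_prime_pow_succ hp.out, Nat.totient_prime_pow_succ hp.out]
  ring

variable [CharZero K] [NormedField L] [NormedAlgebra ℚ_[p] L] [IsUltrametricDist L]
  [Algebra.IsAlgebraic ℚ_[p] L] [IsAlgClosed L] [Algebra K L] [IsScalarTower ℚ_[p] K L]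
  [Algebra.IsIntegral K L]

omit [IsUltrametricDist L] [Algebra.IsAlgebraic ℚ_[p] L] [IsAlgClosed L] in
theorem norm_normalizedTraceEnd_pow_le_one {ε : ℕ → L} (hε0 : ε 0 = 1)
    (hεp : ∀ n, ε (n + 1) ^ p = ε n) {N : ℕ}
    (hN : ∀ m, N ≤ m → Module.finrank ℚ_[p] (IntermediateField.adjoin K {ε (m + 1)}) =
      p * Module.finrank ℚ_[p] (IntermediateField.adjoin K {ε m})) {m : ℕ} (hm : N ≤ m) (i : ℕ) :
    ‖normalizedTraceEnd (IntermediateField.adjoin K {ε N}) L (ε m ^ i)‖ ≤ 1 := by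
  have hp0 := hp.out.pos
  have hnorm : ∀ m, ‖ε m‖ = 1 := by
    intro m
    induction m with
    | zero => simp [hε0]
    | succ m ih =>
      rw [← hεp m, norm_pow] at ih
      exact (pow_eq_one_iff_of_nonneg (norm_nonneg _) hp0.ne').1 ih
  have hne : ∀ m, ε m ≠ 0 := fun m => norm_ne_zero_iff.1 (by simp [hnorm m])
  induction m, hm using Nat.le_induction generalizing i with
  | base =>
    have := normalizedTraceEnd_algebraMap (L := L)
      ((IntermediateField.AdjoinSimple.gen K (ε N)) ^ i)
    rw [map_pow, IntermediateField.AdjoinSimple.algebraMap_gen] at this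
    rw [this, norm_pow, hnorm, one_pow]
  | succ m hm ih =>
    by_cases hi : p ∣ i
    · obtain ⟨t, rfl⟩ := hi
      rw [pow_mul, hεp]
      exact ih t
    · set E := IntermediateField.adjoin K {ε m}
      have : FiniteDimensional K E :=
        IntermediateField.adjoin.finiteDimensional (Algebra.IsIntegral.isIntegral _)
      have hmem : ε m ∈ E := IntermediateField.mem_adjoin_simple_self K (ε m)
      have hgen : ε (m + 1) ∈ IntermediateField.adjoin E {ε (m + 1) ^ i} := by
        obtain ⟨a, ha⟩ := Nat.exists_mul_mod_eq_one_of_coprime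
          ((hp.out.coprime_iff_not_dvd.2 hi).symm) hp.out.one_lt
        have h1 : (ε (m + 1) ^ i) ^ a = ε (m + 1) * ε m ^ (i * a / p) := by
          rw [← pow_mul, ← hεp m, ← pow_mul, ← pow_succ']
          congr 1
          have := Nat.mod_add_div (i * a) p
          omega
        have h2 := div_mem (pow_mem (IntermediateField.mem_adjoin_simple_self E (ε (m + 1) ^ i)) a)
          ((IntermediateField.adjoin E {ε (m + 1) ^ i}).algebraMap_mem
            (⟨ε m, hmem⟩ ^ (i * a / p)))
        rw [h1] at h2
        rwa [show algebraMap E L (⟨ε m, hmem⟩ ^ (i * a / p)) = ε m ^ (i * a / p) from rfl,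
          mul_div_cancel_right₀ _ (pow_ne_zero _ (hne m))] at h2
      have hmin := minpoly_eq_X_pow_sub_C (k := ℚ_[p]) E hp0.ne' (hN m hm) (⟨ε m, hmem⟩ ^ i)
        (y := ε (m + 1) ^ i) (by rw [← pow_mul, mul_comm, pow_mul, hεp]; rfl) hgen
      rw [← normalizedTraceEnd_normalizedTraceEnd
        (adjoin_simple_mono_of_compatible (K := K) p hεp hm),
        normalizedTraceEnd_eq_zero_of_minpoly hp.out.two_le hmin]
      simp

omit [IsAlgClosed L] in
theorem norm_normalizedTraceEnd_le_of_mem_adjoin {ε : ℕ → L} (hε0 : ε 0 = 1)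
    (hε1 : ε 1 ≠ 1) (hεp : ∀ n, ε (n + 1) ^ p = ε n) {N : ℕ}
    (hN : ∀ m, N ≤ m → Module.finrank ℚ_[p] (IntermediateField.adjoin K {ε (m + 1)}) =
      p * Module.finrank ℚ_[p] (IntermediateField.adjoin K {ε m})) {k : ℕ} (hk : N ≤ k + 1)
    {z : L} (hz : z ∈ IntermediateField.adjoin ℚ_[p] {ε (k + 1)}) :
    ‖normalizedTraceEnd (IntermediateField.adjoin K {ε N}) L z‖ ≤ p * ‖z‖ := by
  set τ := normalizedTraceEnd (IntermediateField.adjoin K {ε N}) L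
  have hpow : ∀ j : ℕ, ‖τ ((ε (k + 1) - 1) ^ j)‖ ≤ 1 := by
    intro j
    have : (ε (k + 1) - 1) ^ j = aeval (ε (k + 1)) ((X - 1 : ℤ[X]) ^ j) := by simp
    rw [this, aeval_eq_sum_range, map_sum]
    refine IsUltrametricDist.norm_sum_le_of_forall_le_of_nonneg zero_le_one fun i _ => ?_
    rw [map_zsmul, zsmul_eq_mul, norm_mul]
    exact mul_le_one₀ (IsUltrametricDist.norm_intCast_le_one L _) (norm_nonneg _)
      (norm_normalizedTraceEnd_pow_le_one p hε0 hεp hN hk i)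
  have hprim := isPrimitiveRoot_of_compatible p hε0 hε1 hεp k
  rw [← adjoin_simple_sub_one] at hz
  obtain ⟨g, hg, rfl⟩ := exists_aeval_eq_of_mem_adjoin_simple
    (Algebra.IsIntegral.isIntegral _) hz
  rw [natDegree_minpoly_padic_sub_one p hprim] at hg
  conv_lhs => rw [aeval_eq_sum_range, map_sum]
  refine IsUltrametricDist.norm_sum_le_of_forall_le_of_nonneg (by positivity) fun i _ => ?_
  have : IsScalarTower ℚ_[p] (IntermediateField.adjoin K {ε N}) L :=
    isScalarTower_intermediateField _
  rw [τ.map_smul_of_tower, norm_smul]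
  exact (mul_le_of_le_one_right (norm_nonneg _) (hpow i)).trans
    (norm_coeff_le_of_natDegree_lt_totient p hprim hg i)

theorem exists_bound_norm_normalizedTraceEnd {ε : ℕ → L} (hε0 : ε 0 = 1)
    (hε1 : ε 1 ≠ 1) (hεp : ∀ n, ε (n + 1) ^ p = ε n) (n : ℕ) :
    ∃ C : ℝ, 0 < C ∧ ∀ m, ∀ x ∈ IntermediateField.adjoin K {ε m},
      ‖normalizedTraceEnd (IntermediateField.adjoin K {ε n}) L x‖ ≤ C * ‖x‖ := by
  have hmono := adjoin_simple_mono_of_compatible (K := K) p hεp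
  obtain ⟨N₀, hN₀⟩ := exists_finrank_succ_eq_mul (K := K) p hε0 hε1 hεp
  obtain ⟨N, hN, hnN, hN1⟩ : ∃ N, N₀ ≤ N ∧ n ≤ N ∧ 1 ≤ N :=
    ⟨max N₀ (max n 1), by simp, by simp, by simp⟩
  obtain ⟨α, hα⟩ := Field.exists_primitive_element ℚ_[p] K
  obtain ⟨C, D, hC, hbound⟩ := exists_bound_coeff_of_mem_adjoin_simple p (algebraMap K L α)
  set a : L := algebraMap K L α
  set E := IntermediateField.adjoin K {ε n}
  have : IsScalarTower ℚ_[p] E L := isScalarTower_intermediateField E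
  let M : IntermediateField E L := IntermediateField.extendScalars (hmono hnN)
  have hfin : FiniteDimensional K (IntermediateField.adjoin K {ε N}) :=
    IntermediateField.adjoin.finiteDimensional (Algebra.IsIntegral.isIntegral _)
  have : FiniteDimensional K M := hfin
  have : FiniteDimensional E M := FiniteDimensional.right K E M
  set τ := normalizedTraceEnd (IntermediateField.adjoin K {ε N}) L
  have hτ : ∀ m, ∀ x ∈ IntermediateField.adjoin K {ε m},
      ‖τ x‖ ≤ max 1 ‖a‖ ^ D * (p * (C * ‖x‖)) := by
    intro m x hx
    obtain ⟨k, hk, hmk⟩ : ∃ k, N ≤ k + 1 ∧ m ≤ k + 1 := ⟨max m N, by omega, by omega⟩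
    have hx' : x ∈ (IntermediateField.adjoin K {ε (k + 1)}).restrictScalars ℚ_[p] := hmono hmk hx
    rw [← restrictScalars_adjoin_simple_comm hα] at hx'
    obtain ⟨g, rfl, hgD, hg⟩ := hbound _ x hx'
    conv_lhs => rw [aeval_eq_sum_range, map_sum]
    refine IsUltrametricDist.norm_sum_le_of_forall_le_of_nonneg (by positivity) fun i hi => ?_
    have hsmul : g.coeff i • a ^ i = (α ^ i) • (g.coeff i : L) := by
      rw [Algebra.smul_def, Algebra.smul_def, mul_comm, map_pow]
      rfl
    rw [hsmul, τ.map_smul_of_tower, Algebra.smul_def, map_pow, norm_mul, norm_pow]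
    have hi' : i ≤ D := (Finset.mem_range_succ_iff.1 hi).trans hgD
    gcongr
    · exact (pow_le_pow_left₀ (norm_nonneg _) (le_max_right _ _) _).trans
        (pow_le_pow_right₀ (le_max_left _ _) hi')
    · refine (norm_normalizedTraceEnd_le_of_mem_adjoin p hε0 hε1 hεp
        (fun m hm => hN₀ m (hN.trans hm)) hk (g.coeff i).2).trans ?_
      gcongr
      exact hg i
  refine ⟨‖(Module.finrank E M : L)‖⁻¹ * (max 1 ‖a‖ ^ D * (p * C)) + 1, by positivity,
    fun m x hx => ?_⟩
  rw [← normalizedTraceEnd_normalizedTraceEnd (hmono hnN)]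
  have hmem : τ x ∈ M := (Algebra.normalizedTrace (IntermediateField.adjoin K {ε N}) L x).2
  refine (norm_normalizedTraceEnd_le_of_mem p M hmem).trans ?_
  calc ‖(Module.finrank E M : L)‖⁻¹ * ‖τ x‖
      ≤ ‖(Module.finrank E M : L)‖⁻¹ * (max 1 ‖a‖ ^ D * (p * (C * ‖x‖))) := by
        gcongr
        exact hτ m x hx
    _ = ‖(Module.finrank E M : L)‖⁻¹ * (max 1 ‖a‖ ^ D * (p * C)) * ‖x‖ := by ring
    _ ≤ _ := by
        gcongr
        linarith

end CyclotomicTower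

section Valuation

variable (p : ℕ) [hp : Fact p.Prime] {L : Type*} [Field L] [Algebra ℚ_[p] L]

theorem spectralNorm_eq_rpow_neg [Algebra.IsAlgebraic ℚ_[p] L] (v : L → ℝ)
    (hv_mul : ∀ x y : L, x ≠ 0 → y ≠ 0 → v (x * y) = v x + v y)
    (hv_add : ∀ x y : L, x ≠ 0 → y ≠ 0 → x + y ≠ 0 → min (v x) (v y) ≤ v (x + y))
    (hv_ext : ∀ a : ℚ_[p], a ≠ 0 → v (algebraMap ℚ_[p] L a) = (a.valuation : ℝ))
    {x : L} (hx : x ≠ 0) : spectralNorm ℚ_[p] L x = (p : ℝ) ^ (-v x) := by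
  classical
  have hp1 : (1 : ℝ) < p := by exact_mod_cast hp.out.one_lt
  have hp0 : (0 : ℝ) < p := by linarith
  let f : L → ℝ := fun x => if x = 0 then 0 else (p : ℝ) ^ (-v x)
  have hf0 : f 0 = 0 := if_pos rfl
  have hf : ∀ {x}, x ≠ 0 → f x = (p : ℝ) ^ (-v x) := fun h => if_neg h
  have hf_nonneg : ∀ x, 0 ≤ f x := fun x => by
    dsimp only [f]
    split_ifs <;> positivity
  have hv1 : v 1 = 0 := by
    have := hv_mul 1 1 one_ne_zero one_ne_zero
    rw [mul_one] at this
    linarith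
  have hvneg1 : v (-1) = 0 := by
    have := hv_mul (-1) (-1) (neg_ne_zero.2 one_ne_zero) (neg_ne_zero.2 one_ne_zero)
    rw [neg_mul_neg, mul_one, hv1] at this
    linarith
  have hf_mul : ∀ x y, f (x * y) = f x * f y := by
    intro x y
    by_cases hx : x = 0
    · simp [hx, hf0]
    by_cases hy : y = 0
    · simp [hy, hf0]
    rw [hf hx, hf hy, hf (mul_ne_zero hx hy), hv_mul x y hx hy, neg_add, Real.rpow_add hp0]
  have hf_alg : ∀ a : ℚ_[p], f (algebraMap ℚ_[p] L a) = ‖a‖ := by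
    intro a
    by_cases ha : a = 0
    · simp [ha, hf0]
    rw [hf ((map_ne_zero _).2 ha), hv_ext a ha, Padic.norm_eq_zpow_neg_valuation ha,
      ← Int.cast_neg, Real.rpow_intCast]
  let N : AlgebraNorm ℚ_[p] L :=
    { toFun := f
      map_zero' := hf0
      add_le' := by
        intro x y
        by_cases hx : x = 0
        · simp [hx, hf0]
        by_cases hy : y = 0
        · simp [hy, hf0]
        by_cases hxy : x + y = 0
        · rw [hxy, hf0]
          exact add_nonneg (hf_nonneg _) (hf_nonneg _)
        rcases min_le_iff.1 (hv_add x y hx hy hxy) with h | h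
        · refine le_trans ?_ (le_add_of_nonneg_right (hf_nonneg y))
          rw [hf hx, hf hxy]
          exact Real.rpow_le_rpow_of_exponent_le hp1.le (neg_le_neg h)
        · refine le_trans ?_ (le_add_of_nonneg_left (hf_nonneg x))
          rw [hf hy, hf hxy]
          exact Real.rpow_le_rpow_of_exponent_le hp1.le (neg_le_neg h)
      neg' := by
        intro x
        rw [neg_eq_neg_one_mul, hf_mul, hf (neg_ne_zero.2 one_ne_zero), hvneg1, neg_zero,
          Real.rpow_zero, one_mul]
      mul_le' := fun x y => (hf_mul x y).le
      eq_zero_of_map_eq_zero' := by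
        intro x h
        by_contra hx
        exact (Real.rpow_pos_of_pos hp0 _).ne' ((hf hx).symm.trans h)
      smul' := fun a x => by
        change f (a • x) = ‖a‖ * f x
        rw [Algebra.smul_def, hf_mul, hf_alg] }
  have hpow : IsPowMul N := by
    intro x n hn
    change f (x ^ n) = f x ^ n
    induction n, hn using Nat.le_induction with
    | base => simp
    | succ n _ ih => rw [pow_succ, hf_mul, ih, pow_succ]
  rw [← spectralAlgNorm_def, ← spectralNorm_unique hpow]
  exact hf hx

end Valuation

theorem exists_bound_spectralNorm_normalizedTraceEnd (p : ℕ) [Fact p.Prime] {K L : Type*} [Field K]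
    [CharZero K] [Algebra ℚ_[p] K] [FiniteDimensional ℚ_[p] K] [Field L] [Algebra ℚ_[p] L]
    [Algebra K L] [IsScalarTower ℚ_[p] K L] [Algebra.IsIntegral K L]
    [Algebra.IsAlgebraic ℚ_[p] L] [IsAlgClosed L] {ε : ℕ → L} (hε0 : ε 0 = 1)
    (hε1 : ε 1 ≠ 1) (hεp : ∀ n, ε (n + 1) ^ p = ε n) (n : ℕ) :
    ∃ C : ℝ, 0 < C ∧ ∀ m, ∀ x ∈ IntermediateField.adjoin K {ε m},
      spectralNorm ℚ_[p] L (normalizedTraceEnd (IntermediateField.adjoin K {ε n}) L x) ≤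
        C * spectralNorm ℚ_[p] L x := by
  let := spectralNorm.normedField ℚ_[p] L
  let := spectralNorm.normedAlgebra ℚ_[p] L
  have : IsUltrametricDist L :=
    IsUltrametricDist.isUltrametricDist_of_isNonarchimedean_norm isNonarchimedean_spectralNorm
  exact exists_bound_norm_normalizedTraceEnd p hε0 hε1 hεp n

/-- Uniform boundedness of Tate's normalized trace maps: with `K` a finite extension of
`ℚ_p`, `v` the valuation of `K̄` extending the `p`-adic one (`v p = 1`), and
`K_n = K(ε⁽ⁿ⁾)` for a compatible system `ε⁽ⁿ⁾` of primitive `p^n`-th roots of unity, for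
each `n` there is a constant `c ∈ ℝ` such that for all `m ≥ n` and all `x ∈ K_m`,
`v ([K_m:K_n]⁻¹ · Tr_{K_m/K_n}(x)) ≥ v x - c` (with `v 0 = ∞`). -/
theorem tate_normalized_traces_uniformly_bounded (p : ℕ) [Fact p.Prime]
    (K : Type*) [Field K] [Algebra ℚ_[p] K] [FiniteDimensional ℚ_[p] K]
    (v : AlgebraicClosure K → ℝ)
    (hv_mul : ∀ x y : AlgebraicClosure K, x ≠ 0 → y ≠ 0 → v (x * y) = v x + v y)
    (hv_add : ∀ x y : AlgebraicClosure K,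
      x ≠ 0 → y ≠ 0 → x + y ≠ 0 → min (v x) (v y) ≤ v (x + y))
    (hv_ext : ∀ a : ℚ_[p], a ≠ 0 →
      v (algebraMap K (AlgebraicClosure K) (algebraMap ℚ_[p] K a)) = (a.valuation : ℝ))
    (ε : ℕ → AlgebraicClosure K)
    (hε0 : ε 0 = 1) (hε1 : ε 1 ≠ 1) (hεp : ∀ n, ε (n + 1) ^ p = ε n)
    (n : ℕ) :
    ∃ c : ℝ, ∀ m : ℕ, n ≤ m →
      ∀ hle : IntermediateField.adjoin K {ε n} ≤ IntermediateField.adjoin K {ε m},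
      ∀ x : AlgebraicClosure K, ∀ hx : x ∈ IntermediateField.extendScalars hle,
        x ≠ 0 →
        ∀ T : AlgebraicClosure K,
          T = ((Module.finrank (IntermediateField.adjoin K {ε n})
                  (IntermediateField.extendScalars hle) : AlgebraicClosure K))⁻¹ *
                algebraMap (IntermediateField.adjoin K {ε n}) (AlgebraicClosure K)
                  (Algebra.trace (IntermediateField.adjoin K {ε n})
                    (IntermediateField.extendScalars hle) ⟨x, hx⟩) →
          T = 0 ∨ v x - c ≤ v T := by
  have : CharZero K := charZero_of_injective_algebraMap (algebraMap ℚ_[p] K).injective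
  have : Algebra.IsAlgebraic ℚ_[p] K := Algebra.IsAlgebraic.of_finite ℚ_[p] K
  have : Algebra.IsAlgebraic ℚ_[p] (AlgebraicClosure K) :=
    Algebra.IsAlgebraic.trans ℚ_[p] K (AlgebraicClosure K)
  have hp1 : (1 : ℝ) < p := by exact_mod_cast (Fact.out : p.Prime).one_lt
  have hp0 : (0 : ℝ) < p := by linarith
  have hv : ∀ {x : AlgebraicClosure K}, x ≠ 0 →
      spectralNorm ℚ_[p] (AlgebraicClosure K) x = (p : ℝ) ^ (-v x) := fun hx =>
    spectralNorm_eq_rpow_neg p v hv_mul hv_add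
      (fun a ha => by rw [← hv_ext a ha, ← IsScalarTower.algebraMap_apply]) hx
  obtain ⟨C, hC, hbound⟩ := exists_bound_spectralNorm_normalizedTraceEnd (K := K) p hε0 hε1 hεp n
  refine ⟨Real.logb p C, fun m _ hle x hx hx0 T hT => or_iff_not_imp_left.2 fun hT0 => ?_⟩
  set E := IntermediateField.adjoin K {ε n}
  have hfin : FiniteDimensional K (IntermediateField.adjoin K {ε m}) :=
    IntermediateField.adjoin.finiteDimensional (Algebra.IsIntegral.isIntegral _)
  have : FiniteDimensional K (IntermediateField.extendScalars hle) := hfin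
  have : FiniteDimensional E (IntermediateField.extendScalars hle) :=
    FiniteDimensional.right K E _
  have hTx : T = normalizedTraceEnd E (AlgebraicClosure K) x := by
    rw [hT, normalizedTraceEnd_eq_of_mem (IntermediateField.extendScalars hle) hx]
  have h := hbound m x hx
  rw [← hTx, hv hT0, hv hx0, ← Real.rpow_logb hp0 hp1.ne' hC, ← Real.rpow_add hp0,
    Real.rpow_le_rpow_left_iff hp1] at h
  linarith
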